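/- arXiv:1611.05655 — 2 statements merged into one kernel-verified Lean document; each statement's English description precedes it below -/
import Mathlib

section
/- For all x, y ∈ 𝔽₂^α × R^β, if x·y ≠ 0 in R and the binary dot product Ψ(x)·Ψ(y) equals 0, then the binary dot product Ψ(x)·Ψ((1+u)·y) equals 1. -/
/-- The binary field `𝔽₂`. -/
abbrev F2 : Type := ZMod 2

/-- The ring `R = 𝔽₂[u] = 𝔽₂[X]/(X²)` of dual numbers over `𝔽₂`. -/
abbrev Ru : Type := DualNumber F2

/-- `R` acts on `𝔽₂` through the projection `π : R → 𝔽₂`, `π(u) = 0`. -/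
noncomputable instance : Module Ru F2 :=
  Module.compHom F2 (TrivSqZeroExt.fstHom F2 F2 F2).toRingHom

/-- Coordinatewise extension `ψ : R^β → 𝔽₂^(2β)` of the Gray-like map
`ψ(0)=(0,0), ψ(1)=(0,1), ψ(u)=(1,1), ψ(1+u)=(1,0)`. -/
def psiVec {β : ℕ} (x : Fin β → Ru) : Fin (2 * β) → F2 := fun k =>
  if k.val % 2 = 0 then (x ⟨k.val / 2, by have := k.isLt; omega⟩).snd
  else (x ⟨k.val / 2, by have := k.isLt; omega⟩).fst + (x ⟨k.val / 2, by have := k.isLt; omega⟩).snd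

/-- The map `Ψ : 𝔽₂^α × R^β → 𝔽₂^(α+2β)`, `Ψ(x | x') = (x | ψ(x'))`. -/
def Psi {α β : ℕ} (p : (Fin α → F2) × (Fin β → Ru)) : Fin (α + 2 * β) → F2 :=
  Fin.append p.1 (psiVec p.2)

/-- The `R`-valued inner product `x·y = u·ι(Σᵢ xᵢyᵢ) + Σⱼ x'ⱼ y'ⱼ ∈ R` on `𝔽₂^α × R^β`,
where `ι : 𝔽₂ → R` is the inclusion. -/
noncomputable def innR {α β : ℕ} (x y : (Fin α → F2) × (Fin β → Ru)) : Ru :=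
  DualNumber.eps * algebraMap F2 Ru (∑ i, x.1 i * y.1 i) + ∑ j, x.2 j * y.2 j

theorem sum_fin_two_mul {M : Type*} [AddCommMonoid M] {n : ℕ} (f : Fin (2 * n) → M) :
    ∑ k, f k = ∑ j : Fin n, (f ⟨2 * j, by omega⟩ + f ⟨2 * j + 1, by omega⟩) := by
  rw [← (finProdFinEquiv.trans (finCongr (mul_comm n 2))).sum_comp, Fintype.sum_prod_type]
  refine Finset.sum_congr rfl fun j _ => ?_
  rw [Fin.sum_univ_two]
  congr 2 <;> ext <;> simp [finProdFinEquiv, add_comm]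

theorem psiVec_two_mul {n : ℕ} (x : Fin n → Ru) (j : Fin n) (h : 2 * (j : ℕ) < 2 * n) :
    psiVec x ⟨2 * j, h⟩ = (x j).snd := by
  simp [psiVec]

theorem psiVec_two_mul_add_one {n : ℕ} (x : Fin n → Ru) (j : Fin n)
    (h : 2 * (j : ℕ) + 1 < 2 * n) :
    psiVec x ⟨2 * j + 1, h⟩ = (x j).fst + (x j).snd := by
  have h2 : (2 * (j : ℕ) + 1) / 2 = j := by omega
  simp [psiVec, h2, Nat.add_mod]

theorem sum_psiVec_mul_psiVec {n : ℕ} (x y : Fin n → Ru) :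
    ∑ k, psiVec x k * psiVec y k = (∑ j, x j * y j).fst + (∑ j, x j * y j).snd := by
  rw [sum_fin_two_mul, TrivSqZeroExt.fst_sum, TrivSqZeroExt.snd_sum, ← Finset.sum_add_distrib]
  refine Finset.sum_congr rfl fun j _ => ?_
  rw [psiVec_two_mul, psiVec_two_mul, psiVec_two_mul_add_one, psiVec_two_mul_add_one,
    TrivSqZeroExt.fst_mul, DualNumber.snd_mul]
  linear_combination CharTwo.add_self_eq_zero ((x j).snd * (y j).snd)

theorem sum_Psi_mul_Psi {α β : ℕ} (x y : (Fin α → F2) × (Fin β → Ru)) :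
    ∑ i, Psi x i * Psi y i = (innR x y).fst + (innR x y).snd := by
  simp only [Psi, Fin.sum_univ_add, Fin.append_left, Fin.append_right, sum_psiVec_mul_psiVec,
    innR, TrivSqZeroExt.fst_add, TrivSqZeroExt.snd_add, TrivSqZeroExt.fst_mul,
    DualNumber.snd_mul, DualNumber.fst_eps, DualNumber.snd_eps,
    TrivSqZeroExt.algebraMap_eq_inl, TrivSqZeroExt.fst_inl]
  ring

theorem eps_mul_algebraMap_fst (r : Ru) :
    DualNumber.eps * algebraMap F2 Ru r.fst = DualNumber.eps * r := by
  ext <;> simp [TrivSqZeroExt.algebraMap_eq_inl]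

theorem innR_smul_right {α β : ℕ} (r : Ru) (x y : (Fin α → F2) × (Fin β → Ru)) :
    innR x (r • y) = r * innR x y := by
  have hl : ∑ i, x.1 i * (r • y).1 i = r.fst * ∑ i, x.1 i * y.1 i := by
    rw [Finset.mul_sum]
    refine Finset.sum_congr rfl fun i _ => ?_
    change x.1 i * (r.fst * y.1 i) = _
    ring
  have hr : ∑ j, x.2 j * (r • y).2 j = r * ∑ j, x.2 j * y.2 j := by
    rw [Finset.mul_sum]
    refine Finset.sum_congr rfl fun j _ => ?_
    change x.2 j * (r * y.2 j) = _
    ring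
  rw [innR, innR, hl, hr, map_mul, ← mul_assoc, eps_mul_algebraMap_fst]
  ring

/-- For all `x, y ∈ 𝔽₂^α × R^β`, if `x·y ≠ 0` in `R` and the binary dot product
`Ψ(x)·Ψ(y)` equals `0`, then the binary dot product `Ψ(x)·Ψ((1+u)·y)` equals `1`. -/
theorem psi_dotProduct_one_of_innR_ne_zero (α β : ℕ)
    (x y : (Fin α → F2) × (Fin β → Ru)) (h : innR x y ≠ 0)
    (h0 : (∑ i, Psi x i * Psi y i) = 0) :
    (∑ i, Psi x i * Psi (((1 : Ru) + DualNumber.eps) • y) i) = 1 := by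
  rw [sum_Psi_mul_Psi] at h0
  rw [sum_Psi_mul_Psi, innR_smul_right]
  generalize innR x y = z at h h0
  have hfst : z.fst ≠ 0 := fun hz =>
    h (TrivSqZeroExt.ext hz (by simpa [hz] using h0))
  have hone : ∀ a : F2, a ≠ 0 → a = 1 := by decide
  simp only [TrivSqZeroExt.fst_mul, DualNumber.snd_mul, TrivSqZeroExt.fst_add,
    TrivSqZeroExt.snd_add, TrivSqZeroExt.fst_one, TrivSqZeroExt.snd_one, DualNumber.fst_eps,
    DualNumber.snd_eps]
  linear_combination h0 + hone _ hfst
end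

section
/- Let n be odd, let β be an integer with 0 ≤ β ≤ (n−1)/2, and set α = n − 2β. Then both the repetition code {0, (1,…,1)} ⊆ 𝔽₂^n and the even-weight code {c ∈ 𝔽₂^n : Σ_{i=1}^n c_i = 0} are of the form Ψ(𝒞) for some ℤ₂ℤ₂[u]-additive code 𝒞 ⊆ 𝔽₂^α × R^β. -/
theorem sum_psiVec {β : ℕ} (x : Fin β → Ru) : ∑ k, psiVec x k = ∑ j, (x j).fst := by
  rw [← Equiv.sum_comp (finProdFinEquiv.trans (finCongr (mul_comm β 2))),
    Fintype.sum_prod_type]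
  refine Finset.sum_congr rfl fun j _ => ?_
  have h : (1 + 2 * (j : ℕ)) / 2 = j := by omega
  simp [psiVec, Fin.sum_univ_two, h]
  grind

theorem sum_Psi {α β : ℕ} (p : (Fin α → F2) × (Fin β → Ru)) :
    ∑ k, Psi p k = ∑ i, p.1 i + ∑ j, (p.2 j).fst := by
  simp [Psi, Fin.sum_univ_add, sum_psiVec]

theorem psiVec_surjective {β : ℕ} : Function.Surjective (psiVec (β := β)) := by
  intro c
  refine ⟨fun j => TrivSqZeroExt.inl (c ⟨2 * j, by omega⟩ + c ⟨2 * j + 1, by omega⟩) +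
    TrivSqZeroExt.inr (c ⟨2 * j, by omega⟩), funext fun k => ?_⟩
  unfold psiVec
  split_ifs with h
  · have hk : 2 * (k.val / 2) = k := by omega
    simp [hk]
  · have hk : 2 * (k.val / 2) + 1 = k := by omega
    simp [hk]
    grind

theorem Psi_surjective {α β : ℕ} : Function.Surjective (Psi (α := α) (β := β)) := by
  intro c
  obtain ⟨x, hx⟩ := psiVec_surjective fun k => c (Fin.natAdd α k)
  exact ⟨(fun i => c (Fin.castAdd _ i), x), by simp [Psi, hx, Fin.append_castAdd_natAdd]⟩

theorem Psi_const {α β : ℕ} (a : F2) :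
    Psi ((fun _ => a, fun _ => TrivSqZeroExt.inr a) : (Fin α → F2) × (Fin β → Ru)) =
      fun _ => a := by
  funext k
  refine Fin.addCases (fun i => ?_) (fun i => ?_) k <;> simp [Psi, psiVec]

theorem Ru_smul_F2 (r : Ru) (a : F2) : r • a = r.fst * a := rfl

/-- The additive code whose image under `Psi` is the repetition code. -/
def repetitionCode (α β : ℕ) : Submodule Ru ((Fin α → F2) × (Fin β → Ru)) where
  carrier := Set.range fun a : F2 => (fun _ => a, fun _ => TrivSqZeroExt.inr a)
  zero_mem' := ⟨0, by ext <;> simp⟩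
  add_mem' := by
    rintro _ _ ⟨a, rfl⟩ ⟨b, rfl⟩
    exact ⟨a + b, by ext <;> simp⟩
  smul_mem' := by
    rintro r _ ⟨a, rfl⟩
    exact ⟨r.fst * a, by ext <;> simp [Ru_smul_F2, mul_comm]⟩

/-- The additive code whose image under `Psi` is the even-weight code. -/
def evenCode (α β : ℕ) : Submodule Ru ((Fin α → F2) × (Fin β → Ru)) where
  carrier := {p | ∑ i, p.1 i + ∑ j, (p.2 j).fst = 0}
  zero_mem' := by simp
  add_mem' := by
    intro p q hp hq
    simp only [Set.mem_ofPred_eq] at hp hq ⊢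
    simp only [Prod.fst_add, Prod.snd_add, Pi.add_apply, TrivSqZeroExt.fst_add,
      Finset.sum_add_distrib]
    linear_combination hp + hq
  smul_mem' := by
    intro r p hp
    simp only [Set.mem_ofPred_eq] at hp ⊢
    simp only [Prod.smul_fst, Prod.smul_snd, Pi.smul_apply, smul_eq_mul, Ru_smul_F2,
      TrivSqZeroExt.fst_mul, ← Finset.mul_sum]
    linear_combination r.fst * hp

/-- Let `n` be odd, `0 ≤ β ≤ (n−1)/2` and `α = n − 2β`. Then both the repetition code
`{0, (1,…,1)} ⊆ 𝔽₂^n` and the even-weight code `{c : Σᵢ cᵢ = 0}` are of the form `Ψ(𝒞)`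
for some `ℤ₂ℤ₂[u]`-additive code `𝒞 ⊆ 𝔽₂^α × R^β`. -/
theorem repetition_and_even_code_z2z2u (n β : ℕ) (hn : Odd n) (hβ : β ≤ (n - 1) / 2) :
    (∃ 𝒞 : Submodule Ru ((Fin (n - 2 * β) → F2) × (Fin β → Ru)),
      ({(fun _ => 0), (fun _ => 1)} : Set (Fin n → F2)) =
        (fun p => Psi p ∘
            Fin.cast (by obtain ⟨k, hk⟩ := hn; omega : n = (n - 2 * β) + 2 * β)) ''
          (𝒞 : Set ((Fin (n - 2 * β) → F2) × (Fin β → Ru)))) ∧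
    (∃ 𝒞 : Submodule Ru ((Fin (n - 2 * β) → F2) × (Fin β → Ru)),
      {c : Fin n → F2 | (∑ i, c i) = 0} =
        (fun p => Psi p ∘
            Fin.cast (by obtain ⟨k, hk⟩ := hn; omega : n = (n - 2 * β) + 2 * β)) ''
          (𝒞 : Set ((Fin (n - 2 * β) → F2) × (Fin β → Ru)))) := by
  have h : n = (n - 2 * β) + 2 * β := by obtain ⟨k, hk⟩ := hn; omega
  refine ⟨⟨repetitionCode _ _, ?_⟩, ⟨evenCode _ _, ?_⟩⟩
  · ext c
    constructor
    · rintro (rfl | rfl)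
      · exact ⟨_, ⟨0, rfl⟩, by simp only [Psi_const]; rfl⟩
      · exact ⟨_, ⟨1, rfl⟩, by simp only [Psi_const]; rfl⟩
    · rintro ⟨_, ⟨a, rfl⟩, rfl⟩
      simp only [Psi_const]
      fin_cases a
      · exact Or.inl rfl
      · exact Or.inr rfl
  · ext c
    constructor
    · intro hc
      obtain ⟨p, hp⟩ := Psi_surjective (c ∘ Fin.cast h.symm)
      refine ⟨p, ?_, by simp only [hp]; rfl⟩
      change ∑ i, p.1 i + ∑ j, (p.2 j).fst = 0
      rw [← sum_Psi, hp]
      exact (Equiv.sum_comp (finCongr h.symm) c).trans hc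
    · rintro ⟨p, hp, rfl⟩
      exact (Equiv.sum_comp (finCongr h) (Psi p)).trans ((sum_Psi p).trans hp)
end
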